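/- arXiv:2305.01353 — 3 statements merged into one kernel-verified Lean document; each statement's English description precedes it below -/
import Mathlib

section
/- Let T > 0. Let y₁ : [0,T] → ℝ be continuous and nonnegative, let y₂, y₃ : [0,T] → ℝ be nonnegative and integrable on [0,T], let a : [0,T] → ℝ be nonnegative and integrable on [0,T], and let A ≥ 0 be a real number. Assume that for every t ∈ [0,T], y₁(t) + ∫₀ᵗ y₂(s) ds ≤ A + ∫₀ᵗ a(s)·y₁(s) ds + ∫₀ᵗ y₃(s) ds. Assume moreover that there are constants B ≥ 0 and β > 0 such that for every t ∈ [0,T], ∫₀ᵗ y₃(s) ds ≤ B · (sup_{s ∈ [0,t]} y₁(s))^β · ∫₀ᵗ (y₁(s) + y₂(s)) ds. Set E := exp(∫₀ᵀ a(s) ds) and assume that 8·A·E ≤ (8·B·(1+T)·E)^(−1/β). Then sup_{t ∈ [0,T]} y₁(t) + ∫₀ᵀ y₂(s) ds ≤ 8·A·exp(∫₀ᵀ a(s) ds). -/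
open MeasureTheory Real

/-- The composition of a Lipschitz function with an absolutely continuous function is absolutely
continuous. -/
theorem LipschitzOnWith.comp_absolutelyContinuousOnInterval {X Y : Type*} [PseudoMetricSpace X]
    [PseudoMetricSpace Y] {f : ℝ → X} {g : X → Y} {K : NNReal} {s : Set X} {p q : ℝ}
    (hg : LipschitzOnWith K g s) (hf : AbsolutelyContinuousOnInterval f p q)
    (hfs : Set.MapsTo f (Set.uIcc p q) s) :
    AbsolutelyContinuousOnInterval (g ∘ f) p q := by
  rw [absolutelyContinuousOnInterval_iff] at hf ⊢
  intro ε hε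
  obtain ⟨δ, hδ, h⟩ := hf (ε / (K + 1)) (by positivity)
  refine ⟨δ, hδ, fun I hI hIδ ↦ ?_⟩
  have hsum : ∑ i ∈ Finset.range I.1, dist ((g ∘ f) (I.2 i).1) ((g ∘ f) (I.2 i).2) ≤
      K * ∑ i ∈ Finset.range I.1, dist (f (I.2 i).1) (f (I.2 i).2) := by
    rw [Finset.mul_sum]
    refine Finset.sum_le_sum fun i hi ↦ ?_
    have hmem := hI.1 i hi
    exact hg.dist_le_mul _ (hfs hmem.1) _ (hfs hmem.2)
  calc _ ≤ _ := hsum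
    _ ≤ K * (ε / (K + 1)) := by gcongr; exact (h I hI hIδ).le
    _ < (K + 1) * (ε / (K + 1)) := by gcongr; linarith
    _ = ε := by field_simp

/-- An absolutely continuous function with almost everywhere nonpositive derivative does not
increase between the endpoints. -/
theorem AbsolutelyContinuousOnInterval.le_of_ae_hasDerivAt_nonpos {f f' : ℝ → ℝ} {p q : ℝ}
    (hpq : p ≤ q) (hf : AbsolutelyContinuousOnInterval f p q)
    (hf' : ∀ᵐ x, x ∈ Set.uIcc p q → HasDerivAt f (f' x) x)
    (hnonpos : ∀ x ∈ Set.Icc p q, f' x ≤ 0) : f q ≤ f p := by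
  have h : 0 ≤ ∫ x in p..q, -deriv f x := by
    refine intervalIntegral.integral_nonneg_of_ae_restrict hpq ?_
    rw [Filter.EventuallyLE, ae_restrict_iff' measurableSet_Icc]
    filter_upwards [hf'] with x hx hxI
    rw [(hx (Set.uIcc_of_le hpq ▸ hxI)).deriv]
    simpa using hnonpos x hxI
  rw [intervalIntegral.integral_neg, hf.integral_deriv_eq_sub] at h
  linarith

/-- Integral form of Gronwall's inequality with an integrable coefficient. -/
theorem add_integral_mul_le_mul_exp_integral {u a : ℝ → ℝ} {p q C : ℝ} (hpq : p ≤ q)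
    (hu : ContinuousOn u (Set.Icc p q)) (ha : IntervalIntegrable a volume p q)
    (hann : ∀ t ∈ Set.Icc p q, 0 ≤ a t)
    (h : ∀ t ∈ Set.Icc p q, u t ≤ C + ∫ s in p..t, a s * u s) :
    C + ∫ s in p..q, a s * u s ≤ C * Real.exp (∫ s in p..q, a s) := by
  have hau : IntervalIntegrable (fun s ↦ a s * u s) volume p q :=
    ha.mul_continuousOn (Set.uIcc_of_le hpq ▸ hu)
  have hp : p ∈ Set.uIcc p q := Set.left_mem_uIcc
  have hα := ha.absolutelyContinuousOnInterval_intervalIntegral hp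
  obtain ⟨R, hR⟩ := hα.exists_bound
  obtain ⟨K, hK⟩ := (Real.contDiff_exp.comp contDiff_neg).contDiffOn.exists_lipschitzOnWith
    one_ne_zero (convex_Icc (-R) R) isCompact_Icc
  have hexp := hK.comp_absolutelyContinuousOnInterval hα fun x hx ↦ abs_le.1 (hR x hx)
  have hC : AbsolutelyContinuousOnInterval (fun _ ↦ C) p q :=
    contDiffOn_const.absolutelyContinuousOnInterval
  have hG := (hC.add (hau.absolutelyContinuousOnInterval_intervalIntegral hp)).mul hexp
  have hle := hG.le_of_ae_hasDerivAt_nonpos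
    (f' := fun x ↦ a x * (u x - (C + ∫ s in p..x, a s * u s)) * Real.exp (-∫ s in p..x, a s))
    hpq (by
      filter_upwards [ha.ae_hasDerivAt_integral, hau.ae_hasDerivAt_integral] with x hx hx' hxI
      convert! ((hx' hxI p hp).const_add C).mul (hx hxI p hp).neg.exp using 1
      simp only [Pi.neg_apply]
      ring)
    fun x hx ↦ mul_nonpos_of_nonpos_of_nonneg
      (mul_nonpos_of_nonneg_of_nonpos (hann x hx) (sub_nonpos.2 (h x hx))) (Real.exp_nonneg _)
  simp only [Pi.mul_apply, Pi.add_apply, Function.comp_apply, intervalIntegral.integral_same,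
    neg_zero, Real.exp_zero, add_zero, mul_one, Real.exp_neg] at hle
  rwa [← div_eq_mul_inv, div_le_iff₀ (Real.exp_pos _)] at hle

/-- If a continuous function starts below `θ`, and every bound by `θ` on an initial interval
improves to a strict bound at its endpoint, then the function stays below `θ`. -/
theorem ContinuousOn.lt_of_forall_le_imp_lt {g : ℝ → ℝ} {p q θ : ℝ}
    (hg : ContinuousOn g (Set.Icc p q)) (hp : g p < θ)
    (himp : ∀ t ∈ Set.Icc p q, (∀ s ∈ Set.Icc p t, g s ≤ θ) → g t < θ) :
    ∀ t ∈ Set.Icc p q, g t < θ := by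
  by_contra! hne
  have hcompact : IsCompact (Set.Icc p q ∩ g ⁻¹' Set.Ici θ) :=
    isCompact_Icc.of_isClosed_subset (hg.preimage_isClosed_of_isClosed isClosed_Icc isClosed_Ici)
      Set.inter_subset_left
  obtain ⟨m, ⟨hmI, hmθ⟩, hmin⟩ := hcompact.exists_isLeast hne
  obtain ⟨r, hr, hrθ⟩ := intermediate_value_Icc hmI.1
    (hg.mono (Set.Icc_subset_Icc_right hmI.2)) ⟨hp.le, hmθ⟩
  have hrm : r = m := le_antisymm hr.2 (hmin ⟨⟨hr.1, hr.2.trans hmI.2⟩, hrθ.ge⟩)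
  subst hrm
  refine (himp r hmI fun s hs ↦ ?_).ne hrθ
  by_contra! hsθ
  have hsr : s = r := le_antisymm hs.2 (hmin ⟨⟨hs.1, hs.2.trans hmI.2⟩, hsθ.le⟩)
  exact (hsr ▸ hsθ).ne' hrθ

/-- Continuation argument for the generalized Gronwall inequality: below a threshold `θ` for which
the perturbation is small, the estimated quantity stays at most `θ / 4`. -/
theorem add_integral_le_of_superlinear_perturbation {T A B β θ : ℝ} {y₁ y₂ y₃ a : ℝ → ℝ}
    (hT : 0 < T)
    (hy₁c : ContinuousOn y₁ (Set.Icc 0 T))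
    (hy₁nn : ∀ t ∈ Set.Icc 0 T, 0 ≤ y₁ t)
    (hy₂nn : ∀ t ∈ Set.Icc 0 T, 0 ≤ y₂ t)
    (hann : ∀ t ∈ Set.Icc 0 T, 0 ≤ a t)
    (hy₂int : IntervalIntegrable y₂ volume 0 T)
    (haint : IntervalIntegrable a volume 0 T)
    (hA : 0 ≤ A) (hB : 0 ≤ B) (hβ : 0 < β)
    (hmain : ∀ t ∈ Set.Icc 0 T,
      y₁ t + ∫ s in (0:ℝ)..t, y₂ s ≤
        A + (∫ s in (0:ℝ)..t, a s * y₁ s) + ∫ s in (0:ℝ)..t, y₃ s)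
    (hpert : ∀ t ∈ Set.Icc 0 T,
      (∫ s in (0:ℝ)..t, y₃ s) ≤
        B * (sSup (y₁ '' Set.Icc 0 t)) ^ β * ∫ s in (0:ℝ)..t, (y₁ s + y₂ s))
    (hθ : 0 < θ) (hAθ : 8 * A * Real.exp (∫ s in (0:ℝ)..T, a s) ≤ θ)
    (hBθ : 8 * B * (1 + T) * Real.exp (∫ s in (0:ℝ)..T, a s) * θ ^ β ≤ 1) :
    ∀ t ∈ Set.Icc 0 T, y₁ t + ∫ s in (0:ℝ)..t, y₂ s ≤ θ / 4 := by
  set E := Real.exp (∫ s in (0:ℝ)..T, a s) with hE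
  have hEpos : 0 < E := Real.exp_pos _
  have hsub : ∀ {f : ℝ → ℝ}, IntervalIntegrable f volume 0 T → ∀ t ∈ Set.Icc 0 T,
      IntervalIntegrable f volume 0 t := fun hf t ht ↦ hf.mono_set (by
    rw [Set.uIcc_of_le ht.1, Set.uIcc_of_le hT.le]; exact Set.Icc_subset_Icc_right ht.2)
  have hY₂nn : ∀ t ∈ Set.Icc 0 T, 0 ≤ ∫ s in (0:ℝ)..t, y₂ s := fun t ht ↦
    intervalIntegral.integral_nonneg ht.1 fun s hs ↦ hy₂nn s ⟨hs.1, hs.2.trans ht.2⟩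
  have hpert_le : ∀ t ∈ Set.Icc 0 T, (∀ s ∈ Set.Icc 0 t, y₁ s + ∫ r in (0:ℝ)..s, y₂ r ≤ θ) →
      ∫ s in (0:ℝ)..t, y₃ s ≤ θ / (8 * E) := by
    intro t ht hle
    have htT : Set.Icc 0 t ⊆ Set.Icc 0 T := Set.Icc_subset_Icc_right ht.2
    have hy₁θ : ∀ s ∈ Set.Icc 0 t, y₁ s ≤ θ := fun s hs ↦ by
      linarith [hle s hs, hY₂nn s (htT hs)]
    have hsup : sSup (y₁ '' Set.Icc 0 t) ≤ θ :=
      csSup_le ((Set.nonempty_Icc.2 ht.1).image _) (Set.forall_mem_image.2 hy₁θ)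
    have hsup0 : 0 ≤ sSup (y₁ '' Set.Icc 0 t) :=
      Real.sSup_nonneg (Set.forall_mem_image.2 fun s hs ↦ hy₁nn s (htT hs))
    have hy₁int : IntervalIntegrable y₁ volume 0 t :=
      (hy₁c.mono htT).intervalIntegrable_of_Icc ht.1
    have hy₁I : ∫ s in (0:ℝ)..t, y₁ s ≤ T * θ := by
      calc ∫ s in (0:ℝ)..t, y₁ s ≤ ∫ _ in (0:ℝ)..t, θ :=
            intervalIntegral.integral_mono_on ht.1 hy₁int intervalIntegrable_const hy₁θ
        _ = t * θ := by simp
        _ ≤ T * θ := by gcongr; exact ht.2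
    have htmem : t ∈ Set.Icc 0 t := ⟨ht.1, le_rfl⟩
    have hsum : ∫ s in (0:ℝ)..t, (y₁ s + y₂ s) ≤ (1 + T) * θ := by
      rw [intervalIntegral.integral_add hy₁int (hsub hy₂int t ht)]
      linarith [hle t htmem, hy₁nn t ht]
    calc _ ≤ _ := hpert t ht
      _ ≤ B * (sSup (y₁ '' Set.Icc 0 t)) ^ β * ((1 + T) * θ) := by gcongr
      _ ≤ B * θ ^ β * ((1 + T) * θ) := by gcongr
      _ ≤ θ / (8 * E) := by
        rw [le_div_iff₀ (by positivity)]
        calc _ = 8 * B * (1 + T) * E * θ ^ β * θ := by ring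
          _ ≤ 1 * θ := by gcongr
          _ = θ := one_mul θ
  have himprove : ∀ t ∈ Set.Icc 0 T,
      (∀ s ∈ Set.Icc 0 t, y₁ s + ∫ r in (0:ℝ)..s, y₂ r ≤ θ) →
      y₁ t + ∫ s in (0:ℝ)..t, y₂ s ≤ θ / 4 := by
    intro t ht hle
    have htT : Set.Icc 0 t ⊆ Set.Icc 0 T := Set.Icc_subset_Icc_right ht.2
    have hlin : ∀ s ∈ Set.Icc 0 t, y₁ s + ∫ r in (0:ℝ)..s, y₂ r ≤
        (A + θ / (8 * E)) + ∫ r in (0:ℝ)..s, a r * y₁ r := fun s hs ↦ by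
      linarith [hmain s (htT hs),
        hpert_le s (htT hs) fun r hr ↦ hle r ⟨hr.1, hr.2.trans hs.2⟩]
    have hmono : ∫ s in (0:ℝ)..t, a s ≤ ∫ s in (0:ℝ)..T, a s := by
      refine intervalIntegral.integral_mono_interval le_rfl ht.1 ht.2 ?_ haint
      filter_upwards [ae_restrict_mem measurableSet_Ioc] with s hs
      exact hann s ⟨hs.1.le, hs.2⟩
    calc _ ≤ _ := hlin t ⟨ht.1, le_rfl⟩
      _ ≤ (A + θ / (8 * E)) * Real.exp (∫ s in (0:ℝ)..t, a s) :=
        add_integral_mul_le_mul_exp_integral ht.1 (hy₁c.mono htT) (hsub haint t ht)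
          (fun s hs ↦ hann s (htT hs)) fun s hs ↦ by linarith [hlin s hs, hY₂nn s (htT hs)]
      _ ≤ (A + θ / (8 * E)) * E := by rw [hE]; gcongr
      _ = A * E + θ / 8 := by field_simp
      _ ≤ θ / 4 := by linarith
  have hcont : ContinuousOn (fun t ↦ y₁ t + ∫ s in (0:ℝ)..t, y₂ s) (Set.Icc 0 T) := by
    have h := (hy₂int.absolutelyContinuousOnInterval_intervalIntegral
      Set.left_mem_uIcc).continuousOn
    exact hy₁c.add (Set.uIcc_of_le hT.le ▸ h)
  have hstart : y₁ 0 + ∫ s in (0:ℝ)..0, y₂ s < θ := by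
    have h := hmain 0 ⟨le_rfl, hT.le⟩
    have hE1 : 1 ≤ E := Real.one_le_exp (intervalIntegral.integral_nonneg hT.le hann)
    simp only [intervalIntegral.integral_same, add_zero] at h ⊢
    nlinarith
  have hlt := hcont.lt_of_forall_le_imp_lt hstart fun t ht hle ↦
    (himprove t ht hle).trans_lt (by linarith)
  exact fun t ht ↦ himprove t ht fun s hs ↦ (hlt s ⟨hs.1, hs.2.trans ht.2⟩).le

/-- Generalized Gronwall lemma: a Gronwall-type inequality in which the perturbation
term `y₃` is controlled superlinearly (with exponent `β > 0`) by the quantities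
`y₁` and `y₂` being estimated, under a smallness condition on the data. -/
theorem generalized_gronwall
    (T : ℝ) (hT : 0 < T)
    (y₁ y₂ y₃ a : ℝ → ℝ) (A B β : ℝ)
    (hy₁c : ContinuousOn y₁ (Set.Icc 0 T))
    (hy₁nn : ∀ t ∈ Set.Icc 0 T, 0 ≤ y₁ t)
    (hy₂nn : ∀ t ∈ Set.Icc 0 T, 0 ≤ y₂ t)
    (hy₃nn : ∀ t ∈ Set.Icc 0 T, 0 ≤ y₃ t)
    (hann : ∀ t ∈ Set.Icc 0 T, 0 ≤ a t)
    (hy₂int : IntervalIntegrable y₂ MeasureTheory.volume 0 T)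
    (hy₃int : IntervalIntegrable y₃ MeasureTheory.volume 0 T)
    (haint : IntervalIntegrable a MeasureTheory.volume 0 T)
    (hA : 0 ≤ A) (hB : 0 ≤ B) (hβ : 0 < β)
    (hmain : ∀ t ∈ Set.Icc 0 T,
      y₁ t + ∫ s in (0:ℝ)..t, y₂ s ≤
        A + (∫ s in (0:ℝ)..t, a s * y₁ s) + ∫ s in (0:ℝ)..t, y₃ s)
    (hpert : ∀ t ∈ Set.Icc 0 T,
      (∫ s in (0:ℝ)..t, y₃ s) ≤
        B * (sSup (y₁ '' Set.Icc 0 t)) ^ β * ∫ s in (0:ℝ)..t, (y₁ s + y₂ s))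
    (hsmall : 8 * A * Real.exp (∫ s in (0:ℝ)..T, a s) ≤
        (8 * B * (1 + T) * Real.exp (∫ s in (0:ℝ)..T, a s)) ^ (-(1 / β))) :
    sSup (y₁ '' Set.Icc 0 T) + (∫ s in (0:ℝ)..T, y₂ s) ≤
      8 * A * Real.exp (∫ s in (0:ℝ)..T, a s) := by
  set E := Real.exp (∫ s in (0:ℝ)..T, a s)
  have hEpos : 0 < E := Real.exp_pos _
  have hbound : ∀ θ, 0 < θ → 8 * A * E ≤ θ → 8 * B * (1 + T) * E * θ ^ β ≤ 1 →
      sSup (y₁ '' Set.Icc 0 T) + (∫ s in (0:ℝ)..T, y₂ s) ≤ θ := by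
    intro θ hθ hAθ hBθ
    have hle := add_integral_le_of_superlinear_perturbation hT hy₁c hy₁nn hy₂nn hann hy₂int haint
      hA hB hβ hmain hpert hθ hAθ hBθ
    have hsup : sSup (y₁ '' Set.Icc 0 T) ≤ θ / 4 := by
      refine csSup_le ((Set.nonempty_Icc.2 hT.le).image _) (Set.forall_mem_image.2 fun t ht ↦ ?_)
      have hY₂ : 0 ≤ ∫ s in (0:ℝ)..t, y₂ s :=
        intervalIntegral.integral_nonneg ht.1 fun s hs ↦ hy₂nn s ⟨hs.1, hs.2.trans ht.2⟩
      linarith [hle t ht]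
    have hTmem : T ∈ Set.Icc 0 T := ⟨hT.le, le_rfl⟩
    linarith [hle T hTmem, hy₁nn T hTmem]
  set D := 8 * B * (1 + T) * E
  have hD0 : 0 ≤ D := by positivity
  have hsmall_le : ∀ θ, 0 < θ → θ ≤ D ^ (-(1 / β)) → D * θ ^ β ≤ 1 := by
    intro θ hθ hle
    rcases hD0.eq_or_lt with hD | hD
    · simp [← hD]
    calc D * θ ^ β ≤ D * (D ^ (-(1 / β))) ^ β := by gcongr
      _ = D * D ^ (-1 : ℝ) := by
        rw [← Real.rpow_mul hD0]; congr 2; field_simp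
      _ = 1 := by rw [Real.rpow_neg_one, mul_inv_cancel₀ hD.ne']
  rcases hA.eq_or_lt with hA0 | hApos
  · have hzero : 8 * A * E = 0 := by simp [← hA0]
    rw [hzero]
    refine le_of_forall_pos_le_add fun ε hε ↦ ?_
    rw [zero_add]
    rcases hD0.eq_or_lt with hD | hD
    · exact hbound ε hε (hzero.le.trans hε.le) (by simp [← hD])
    · have hpos : 0 < min ε (D ^ (-(1 / β))) := lt_min hε (Real.rpow_pos_of_pos hD _)
      exact (hbound _ hpos (hzero.le.trans hpos.le) (hsmall_le _ hpos (min_le_right _ _))).trans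
        (min_le_left _ _)
  · have hpos : 0 < 8 * A * E := by positivity
    exact hbound _ hpos le_rfl (hsmall_le _ hpos hsmall)
end

section
/- Let X be a real normed vector space, let t_{n−1} < t_n be real numbers with τ := t_n − t_{n−1}, and let a, b, c ∈ X. Define u(t) = ((t − t_{n−1})/τ)·a + ((t_n − t)/τ)·b + (1/2)(t − t_{n−1})(t − t_n)·c. Then ∫_{t_{n−1}}^{t_n} ‖u(t)‖² dt ≤ (τ/3)·(‖a‖² + ‖b‖² + ‖a‖·‖b‖) + (τ³/12)·‖c‖·(‖a‖ + ‖b‖) + (τ⁵/120)·‖c‖². -/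
open intervalIntegral

/-- The integral over `[r, s]` of the square of a quadratic polynomial in `t - r`. -/
theorem integral_sq_quadratic (r s p q k : ℝ) :
    (∫ t in r..s, (p + q * (t - r) + k * (t - r) ^ 2) ^ 2) =
      p ^ 2 * (s - r) + p * q * (s - r) ^ 2 + (q ^ 2 + 2 * p * k) / 3 * (s - r) ^ 3
        + q * k / 2 * (s - r) ^ 4 + k ^ 2 / 5 * (s - r) ^ 5 := by
  rw [intervalIntegral.integral_comp_sub_right (fun x => (p + q * x + k * x ^ 2) ^ 2) r, sub_self]
  have hderiv (x : ℝ) : HasDerivAt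
      (fun x : ℝ => p ^ 2 * x + p * q * x ^ 2 + (q ^ 2 + 2 * p * k) / 3 * x ^ 3
        + q * k / 2 * x ^ 4 + k ^ 2 / 5 * x ^ 5)
      ((p + q * x + k * x ^ 2) ^ 2) x := by
    refine HasDerivAt.congr_deriv ((((((hasDerivAt_id x).const_mul (p ^ 2)).add
      ((hasDerivAt_pow 2 x).const_mul (p * q))).add
      ((hasDerivAt_pow 3 x).const_mul ((q ^ 2 + 2 * p * k) / 3))).add
      ((hasDerivAt_pow 4 x).const_mul (q * k / 2))).add
      ((hasDerivAt_pow 5 x).const_mul (k ^ 2 / 5))) ?_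
    norm_num
    ring
  rw [intervalIntegral.integral_eq_sub_of_hasDerivAt (fun x _ => hderiv x)
    (Continuous.intervalIntegrable (by fun_prop) _ _)]
  ring

/-- The squared-norm integral of the piecewise quadratic time reconstruction
`u(t) = ((t − t_{n−1})/τ)·a + ((t_n − t)/τ)·b + (1/2)(t − t_{n−1})(t − t_n)·c`
over `[t_{n−1}, t_n]` is bounded by
`(τ/3)(‖a‖² + ‖b‖² + ‖a‖‖b‖) + (τ³/12)‖c‖(‖a‖ + ‖b‖) + (τ⁵/120)‖c‖²`. -/
theorem quadratic_reconstruction_sq_integral_bound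
    {X : Type*} [NormedAddCommGroup X] [NormedSpace ℝ X]
    (tnm1 tn : ℝ) (h : tnm1 < tn) (τ : ℝ) (hτ : τ = tn - tnm1)
    (a b c : X) (u : ℝ → X)
    (hu : ∀ t : ℝ, u t = ((t - tnm1) / τ) • a + ((tn - t) / τ) • b
        + ((1 / 2) * (t - tnm1) * (t - tn)) • c) :
    (∫ t in tnm1..tn, ‖u t‖ ^ 2) ≤
      τ / 3 * (‖a‖ ^ 2 + ‖b‖ ^ 2 + ‖a‖ * ‖b‖)
        + τ ^ 3 / 12 * ‖c‖ * (‖a‖ + ‖b‖)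
        + τ ^ 5 / 120 * ‖c‖ ^ 2 := by
  have hτ_pos : 0 < τ := by linarith
  have hpoint : ∀ t ∈ Set.Icc tnm1 tn, ‖u t‖ ^ 2 ≤
      (‖b‖ + ((‖a‖ - ‖b‖) / τ + τ * ‖c‖ / 2) * (t - tnm1)
        + (-‖c‖ / 2) * (t - tnm1) ^ 2) ^ 2 := by
    intro t ht
    have h₁ : 0 ≤ t - tnm1 := sub_nonneg.2 ht.1
    have h₂ : 0 ≤ tn - t := sub_nonneg.2 ht.2
    have hw : 1 / 2 * (t - tnm1) * (t - tn) ≤ 0 :=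
      mul_nonpos_of_nonneg_of_nonpos (by positivity) (by linarith)
    refine pow_le_pow_left₀ (norm_nonneg _) ?_ 2
    rw [hu]
    refine norm_add₃_le.trans_eq ?_
    rw [norm_smul, norm_smul, norm_smul, Real.norm_of_nonneg (div_nonneg h₁ hτ_pos.le),
      Real.norm_of_nonneg (div_nonneg h₂ hτ_pos.le), Real.norm_of_nonpos hw]
    obtain rfl : tn = τ + tnm1 := by linarith
    field_simp
    ring
  have hcont : Continuous u := by
    rw [funext hu]
    fun_prop
  refine (intervalIntegral.integral_mono_on h.le
    (Continuous.intervalIntegrable (by fun_prop) _ _)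
    (Continuous.intervalIntegrable (by fun_prop) _ _) hpoint).trans_eq ?_
  rw [integral_sq_quadratic, ← hτ]
  field_simp
  ring
end

section
/- Let X be a real normed vector space, let τ_n > 0 and τ_{n−1} > 0, let t_{n−1} ∈ ℝ and t_n := t_{n−1} + τ_n. Let ε^n, ε^{n−1}, ε^{n−2} ∈ X and let C₀ ≥ 0 and E_n, E_{n−1}, E_{n−2} ≥ 0 be real numbers with ‖ε^n‖ ≤ C₀·E_n, ‖ε^{n−1}‖ ≤ C₀·E_{n−1}, ‖ε^{n−2}‖ ≤ C₀·E_{n−2}. Define the second divided difference d := (2/(τ_n + τ_{n−1}))·((ε^n − ε^{n−1})/τ_n − (ε^{n−1} − ε^{n−2})/τ_{n−1}) and the quadratic reconstruction ε(t) := ((t − t_{n−1})/τ_n)·ε^n + ((t_n − t)/τ_n)·ε^{n−1} + (1/2)(t − t_{n−1})(t − t_n)·d. Then ∫_{t_{n−1}}^{t_n} ‖ε(t)‖² dt ≤ (C₀²/3)·τ_n·(E_n² + E_{n−1}² + E_n·E_{n−1}) + C₀²·((τ_n²·τ_{n−1}·(E_n + E_{n−1}) + τ_n³·(E_{n−1}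 + E_{n−2}))/(6·τ_{n−1}·(τ_n + τ_{n−1})))·(E_n + E_{n−1}) + C₀²·τ_n³·((τ_{n−1}·(E_n + E_{n−1}) + τ_n·(E_{n−1} + E_{n−2}))²/(30·τ_{n−1}²·(τ_n + τ_{n−1})²)). -/
open intervalIntegral

/-- The square of a quadratic polynomial, given by its end values `b`, `a` on `[c, c + τ]` and a
quadratic bubble with coefficient `D`, has an explicit integral. -/
theorem integral_sq_linear_add_bubble (c a b D : ℝ) {τ : ℝ} (hτ : τ ≠ 0) :
    (∫ t in c..(c + τ), ((t - c) / τ * a + (c + τ - t) / τ * b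
        + (1 / 2) * (t - c) * (c + τ - t) * D) ^ 2) =
      τ / 3 * (a ^ 2 + b ^ 2 + a * b) + D * (a + b) * τ ^ 3 / 12 + D ^ 2 * τ ^ 5 / 120 := by
  set u : ℝ := (a - b) / τ + D / 2 * τ with hu
  have key : ∀ t ∈ Set.uIcc c (c + τ), HasDerivAt
      (fun t : ℝ => b ^ 2 * (t - c) + b * u * (t - c) ^ 2 + (u ^ 2 - b * D) / 3 * (t - c) ^ 3
        - u * D / 4 * (t - c) ^ 4 + D ^ 2 / 20 * (t - c) ^ 5)
      (((t - c) / τ * a + (c + τ - t) / τ * b + (1 / 2) * (t - c) * (c + τ - t) * D) ^ 2) t := by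
    intro t _
    have h : HasDerivAt (fun t : ℝ => t - c) 1 t := (hasDerivAt_id t).sub_const c
    refine (((((h.const_mul (b ^ 2)).add ((h.pow 2).const_mul (b * u))).add
      ((h.pow 3).const_mul ((u ^ 2 - b * D) / 3))).sub
      ((h.pow 4).const_mul (u * D / 4))).add ((h.pow 5).const_mul (D ^ 2 / 20))).congr_deriv ?_
    have hlin : (t - c) / τ * a + (c + τ - t) / τ * b + (1 / 2) * (t - c) * (c + τ - t) * D
        = b + u * (t - c) - D / 2 * (t - c) ^ 2 := by
      rw [hu]; field_simp; ring
    rw [hlin]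
    push_cast
    ring
  rw [integral_eq_sub_of_hasDerivAt key (Continuous.intervalIntegrable (by fun_prop) _ _), hu]
  field_simp
  ring

/-- The norm of a second divided difference is bounded through the norms of its nodes. -/
theorem norm_second_divided_difference_le {X : Type*} [NormedAddCommGroup X] [NormedSpace ℝ X]
    {τ σ a b c : ℝ} (hτ : 0 < τ) (hσ : 0 < σ) {x y z : X}
    (hx : ‖x‖ ≤ a) (hy : ‖y‖ ≤ b) (hz : ‖z‖ ≤ c) :
    ‖(2 / (τ + σ)) • (τ⁻¹ • (x - y) - σ⁻¹ • (y - z))‖ ≤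
      2 / (τ + σ) * (τ⁻¹ * (a + b) + σ⁻¹ * (b + c)) := by
  rw [norm_smul, Real.norm_of_nonneg (by positivity)]
  gcongr
  refine (norm_sub_le _ _).trans ?_
  rw [norm_smul, norm_smul, Real.norm_of_nonneg (by positivity : 0 ≤ τ⁻¹),
    Real.norm_of_nonneg (by positivity : 0 ≤ σ⁻¹)]
  gcongr
  · exact (norm_sub_le _ _).trans (add_le_add hx hy)
  · exact (norm_sub_le _ _).trans (add_le_add hy hz)

/-- Bound for the squared-norm integral of the piecewise quadratic time
reconstruction of the elliptic reconstruction errors `ε^n, ε^{n−1}, ε^{n−2}`,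
whose norms are controlled by recovery-type estimators `C₀·E_j`; the right-hand
side is the square of the space error indicator `(ℰ̃_u^n)²`. -/
theorem elliptic_reconstruction_quadratic_bound
    {X : Type*} [NormedAddCommGroup X] [NormedSpace ℝ X]
    (τn τnm1 : ℝ) (hτn : 0 < τn) (hτnm1 : 0 < τnm1)
    (tnm1 : ℝ) (tn : ℝ) (htn : tn = tnm1 + τn)
    (εn εnm1 εnm2 : X) (C₀ En Enm1 Enm2 : ℝ)
    (hC₀ : 0 ≤ C₀) (hEn : 0 ≤ En) (hEnm1 : 0 ≤ Enm1) (hEnm2 : 0 ≤ Enm2)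
    (hbn : ‖εn‖ ≤ C₀ * En) (hbnm1 : ‖εnm1‖ ≤ C₀ * Enm1) (hbnm2 : ‖εnm2‖ ≤ C₀ * Enm2)
    (d : X)
    (hd : d = (2 / (τn + τnm1)) • (τn⁻¹ • (εn - εnm1) - τnm1⁻¹ • (εnm1 - εnm2)))
    (ε : ℝ → X)
    (hε : ∀ t : ℝ, ε t = ((t - tnm1) / τn) • εn + ((tn - t) / τn) • εnm1
        + ((1 / 2) * (t - tnm1) * (t - tn)) • d) :
    (∫ t in tnm1..tn, ‖ε t‖ ^ 2) ≤
      C₀ ^ 2 / 3 * τn * (En ^ 2 + Enm1 ^ 2 + En * Enm1)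
        + C₀ ^ 2 * ((τn ^ 2 * τnm1 * (En + Enm1) + τn ^ 3 * (Enm1 + Enm2)) /
            (6 * τnm1 * (τn + τnm1))) * (En + Enm1)
        + C₀ ^ 2 * τn ^ 3 * ((τnm1 * (En + Enm1) + τn * (Enm1 + Enm2)) ^ 2 /
            (30 * τnm1 ^ 2 * (τn + τnm1) ^ 2)) := by
  subst htn
  set D : ℝ := 2 / (τn + τnm1) *
    (τn⁻¹ * (C₀ * En + C₀ * Enm1) + τnm1⁻¹ * (C₀ * Enm1 + C₀ * Enm2)) with hD
  have hdD : ‖d‖ ≤ D := hd ▸ norm_second_divided_difference_le hτn hτnm1 hbn hbnm1 hbnm2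
  have hcont : Continuous ε := by
    rw [funext hε]
    fun_prop
  have hpoint : ∀ t ∈ Set.Icc tnm1 (tnm1 + τn), ‖ε t‖ ^ 2 ≤
      ((t - tnm1) / τn * (C₀ * En) + (tnm1 + τn - t) / τn * (C₀ * Enm1)
        + (1 / 2) * (t - tnm1) * (tnm1 + τn - t) * D) ^ 2 := by
    rintro t ⟨h₁, h₂⟩
    have hl : 0 ≤ t - tnm1 := sub_nonneg.2 h₁
    have hr : 0 ≤ tnm1 + τn - t := sub_nonneg.2 h₂
    have hbubble : ‖(1 / 2) * (t - tnm1) * (t - (tnm1 + τn))‖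
        = (1 / 2) * (t - tnm1) * (tnm1 + τn - t) := by
      rw [← neg_sub (tnm1 + τn) t, mul_neg, norm_neg, Real.norm_of_nonneg (by positivity)]
    rw [hε t]
    gcongr
    refine norm_add₃_le.trans ?_
    rw [norm_smul, norm_smul, norm_smul, hbubble, Real.norm_of_nonneg (div_nonneg hl hτn.le),
      Real.norm_of_nonneg (div_nonneg hr hτn.le)]
    gcongr
  refine (integral_mono_on (by linarith) (Continuous.intervalIntegrable (by fun_prop) _ _)
    (Continuous.intervalIntegrable (by fun_prop) _ _) hpoint).trans (le_of_eq ?_)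
  rw [integral_sq_linear_add_bubble _ _ _ _ hτn.ne', hD]
  field_simp
  ring
end
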